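/- For every convex body K ⊂ ℝ^N and every unit vector ω ∈ S^{N-1}, one has R_K(ω) ≥ ⟨M_K, ω⟩, where M_K is the center of mass of K; moreover, equality R_K(ω) = ⟨M_K, ω⟩ holds for a given ω if and only if K is ω-symmetric, i.e. T_{λ,ω}(K) = K for some λ ∈ ℝ. -/

import Mathlib

open MeasureTheory Set Metric
open scoped RealInnerProductSpace ENNReal NNReal

noncomputable section

/-- Reflection of `x` across the hyperplane `{z : ⟪z, ω⟫ = l}` (for a unit vector `ω`). -/
def reflectH {N : ℕ} (l : ℝ) (ω x : EuclideanSpace ℝ (Fin N)) : EuclideanSpace ℝ (Fin N) :=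
  x + (2 * (l - ⟪x, ω⟫)) • ω

/-- The maximal folding function of a set `K`:
`R_K(ω) = inf {l : the reflection of K ∩ {⟪·,ω⟫ ≥ l} across {⟪·,ω⟫ = l} lies in K}`. -/
def foldingFn {N : ℕ} (K : Set (EuclideanSpace ℝ (Fin N))) (ω : EuclideanSpace ℝ (Fin N)) : ℝ :=
  sInf {l : ℝ | reflectH l ω '' {x ∈ K | l ≤ ⟪x, ω⟫} ⊆ K}

/-- The heart of a set `K`. -/
def heart {N : ℕ} (K : Set (EuclideanSpace ℝ (Fin N))) : Set (EuclideanSpace ℝ (Fin N)) :=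
  {x ∈ K | ∀ ω : EuclideanSpace ℝ (Fin N), ‖ω‖ = 1 → ⟪x, ω⟫ ≤ foldingFn K ω}

/-- The center of mass of `K` (w.r.t. Lebesgue measure). -/
def centerOfMass {N : ℕ} (K : Set (EuclideanSpace ℝ (Fin N))) : EuclideanSpace ℝ (Fin N) :=
  (volume K).toReal⁻¹ • ∫ y in K, y

lemma inner_reflectH {N : ℕ} (l : ℝ) {ω : EuclideanSpace ℝ (Fin N)} (hω : ‖ω‖ = 1)
    (x : EuclideanSpace ℝ (Fin N)) : ⟪reflectH l ω x, ω⟫ = 2 * l - ⟪x, ω⟫ := by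
  simp only [reflectH, inner_add_left, real_inner_smul_left, real_inner_self_eq_norm_sq, hω]
  ring

lemma reflectH_reflectH {N : ℕ} (l : ℝ) {ω : EuclideanSpace ℝ (Fin N)} (hω : ‖ω‖ = 1)
    (x : EuclideanSpace ℝ (Fin N)) : reflectH l ω (reflectH l ω x) = x := by
  rw [reflectH, inner_reflectH l hω, reflectH, add_assoc, ← add_smul]
  ring_nf
  simp

lemma continuous_reflectH {N : ℕ} (l : ℝ) (ω : EuclideanSpace ℝ (Fin N)) :
    Continuous (reflectH l ω) := by
  unfold reflectH
  fun_prop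

lemma measurePreserving_reflectH {N : ℕ} (l : ℝ) {ω : EuclideanSpace ℝ (Fin N)} (hω : ‖ω‖ = 1) :
    MeasurePreserving (reflectH l ω) volume volume := by
  have h : reflectH l ω = (fun x => x + (2 * l) • ω) ∘ (ℝ ∙ ω)ᗮ.reflection := by
    ext1 x
    simp only [Function.comp, Submodule.reflection_orthogonal_apply,
      Submodule.reflection_singleton_apply, hω, reflectH]
    rw [real_inner_comm]
    simp only [RCLike.ofReal_real_eq_id, id, one_pow, div_one, mul_sub, sub_smul, mul_smul, two_smul]
    abel
  rw [h]
  exact (measurePreserving_add_right volume _).comp (LinearIsometryEquiv.measurePreserving _)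

lemma measurableEmbedding_reflectH {N : ℕ} (l : ℝ) {ω : EuclideanSpace ℝ (Fin N)} (hω : ‖ω‖ = 1) :
    MeasurableEmbedding (reflectH l ω) :=
  (continuous_reflectH l ω).measurableEmbedding
    (Function.LeftInverse.injective (reflectH_reflectH l hω))

lemma setIntegral_inner_sub_eq_zero {N : ℕ} {A : Set (EuclideanSpace ℝ (Fin N))} {l : ℝ}
    {ω : EuclideanSpace ℝ (Fin N)} (hω : ‖ω‖ = 1) (hA : reflectH l ω ⁻¹' A = A) :
    ∫ y in A, (⟪y, ω⟫ - l) = 0 := by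
  have h := (measurePreserving_reflectH l hω).setIntegral_preimage_emb
    (measurableEmbedding_reflectH l hω) (fun y => ⟪y, ω⟫ - l) A
  have h2 : ∀ y, ⟪reflectH l ω y, ω⟫ - l = -(⟪y, ω⟫ - l) := fun y => by
    rw [inner_reflectH l hω]; ring
  simp only [hA, h2, integral_neg] at h
  linarith

lemma volume_toReal_pos {N : ℕ} {K : Set (EuclideanSpace ℝ (Fin N))}
    (hKcpt : IsCompact K) (hKint : (interior K).Nonempty) : 0 < (volume K).toReal :=
  ENNReal.toReal_pos (Measure.measure_pos_of_nonempty_interior volume hKint).ne' hKcpt.measure_lt_top.ne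

lemma integrableOn_inner_sub {N : ℕ} {K : Set (EuclideanSpace ℝ (Fin N))}
    (hKcpt : IsCompact K) (l : ℝ) (ω : EuclideanSpace ℝ (Fin N)) :
    IntegrableOn (fun y => ⟪y, ω⟫ - l) K :=
  ContinuousOn.integrableOn_compact hKcpt (by fun_prop)

lemma inner_centerOfMass_sub {N : ℕ} {K : Set (EuclideanSpace ℝ (Fin N))}
    (hKcpt : IsCompact K) (hKint : (interior K).Nonempty) (l : ℝ)
    (ω : EuclideanSpace ℝ (Fin N)) :
    ⟪centerOfMass K, ω⟫ - l = (volume K).toReal⁻¹ * ∫ y in K, (⟪y, ω⟫ - l) := by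
  have hv := volume_toReal_pos hKcpt hKint
  have hid : IntegrableOn (fun y : EuclideanSpace ℝ (Fin N) => y) K :=
    ContinuousOn.integrableOn_compact hKcpt (by fun_prop)
  have hin : IntegrableOn (fun y : EuclideanSpace ℝ (Fin N) => ⟪y, ω⟫) K :=
    ContinuousOn.integrableOn_compact hKcpt (by fun_prop)
  have hc : IntegrableOn (fun _ : EuclideanSpace ℝ (Fin N) => l) K :=
    ContinuousOn.integrableOn_compact hKcpt (by fun_prop)
  have h1 : ∫ y in K, ⟪y, ω⟫ = ⟪∫ y in K, y, ω⟫ := by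
    simp only [real_inner_comm ω]
    exact integral_inner (𝕜 := ℝ) hid ω
  rw [integral_sub hin hc, h1, setIntegral_const, centerOfMass, real_inner_smul_left, smul_eq_mul,
    Measure.real]
  field_simp

/-- The points of `K` whose reflection leaves `K` carry the whole integral of the signed distance
to the folding hyperplane. -/
lemma setIntegral_inner_sub_eq_diff {N : ℕ} {K : Set (EuclideanSpace ℝ (Fin N))}
    (hKcpt : IsCompact K) {l : ℝ} {ω : EuclideanSpace ℝ (Fin N)} (hω : ‖ω‖ = 1) :
    ∫ y in K, (⟪y, ω⟫ - l) = ∫ y in K \ reflectH l ω ⁻¹' K, (⟪y, ω⟫ - l) := by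
  have hm : MeasurableSet (reflectH l ω ⁻¹' K) :=
    (continuous_reflectH l ω).measurable hKcpt.measurableSet
  have h0 : ∫ y in K ∩ reflectH l ω ⁻¹' K, (⟪y, ω⟫ - l) = 0 := by
    apply setIntegral_inner_sub_eq_zero hω
    ext y
    simp only [mem_preimage, mem_inter_iff, reflectH_reflectH l hω]
    tauto
  rw [← integral_inter_add_sdiff hm (integrableOn_inner_sub hKcpt l ω), h0, zero_add]

lemma inner_sub_neg_of_mem_diff {N : ℕ} {K : Set (EuclideanSpace ℝ (Fin N))} {l : ℝ}
    {ω : EuclideanSpace ℝ (Fin N)}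
    (hl : reflectH l ω '' {x ∈ K | l ≤ ⟪x, ω⟫} ⊆ K) {y : EuclideanSpace ℝ (Fin N)}
    (hy : y ∈ K \ reflectH l ω ⁻¹' K) : ⟪y, ω⟫ - l < 0 := by
  by_contra! h
  exact hy.2 (hl ⟨y, ⟨hy.1, by linarith⟩, rfl⟩)

lemma inner_centerOfMass_le_of_image_subset {N : ℕ} {K : Set (EuclideanSpace ℝ (Fin N))}
    (hKcpt : IsCompact K) (hKint : (interior K).Nonempty) {l : ℝ}
    {ω : EuclideanSpace ℝ (Fin N)} (hω : ‖ω‖ = 1)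
    (hl : reflectH l ω '' {x ∈ K | l ≤ ⟪x, ω⟫} ⊆ K) : ⟪centerOfMass K, ω⟫ ≤ l := by
  have h := inner_centerOfMass_sub hKcpt hKint l ω
  have hv := volume_toReal_pos hKcpt hKint
  have hm : MeasurableSet (reflectH l ω ⁻¹' K) :=
    (continuous_reflectH l ω).measurable hKcpt.measurableSet
  have hneg : ∫ y in K, (⟪y, ω⟫ - l) ≤ 0 := by
    rw [setIntegral_inner_sub_eq_diff hKcpt hω]
    exact setIntegral_nonpos (hKcpt.measurableSet.diff hm)
      fun y hy => (inner_sub_neg_of_mem_diff hl hy).le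
  have := mul_nonpos_of_nonneg_of_nonpos (inv_nonneg.2 hv.le) hneg
  linarith

lemma reflectH_image_eq_of_inner_centerOfMass_eq {N : ℕ} {K : Set (EuclideanSpace ℝ (Fin N))}
    (hKcpt : IsCompact K) (hKconv : Convex ℝ K) (hKint : (interior K).Nonempty) {l : ℝ}
    {ω : EuclideanSpace ℝ (Fin N)} (hω : ‖ω‖ = 1)
    (hl : reflectH l ω '' {x ∈ K | l ≤ ⟪x, ω⟫} ⊆ K) (hM : ⟪centerOfMass K, ω⟫ = l) :
    reflectH l ω '' K = K := by
  have h := inner_centerOfMass_sub hKcpt hKint l ω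
  have hv := volume_toReal_pos hKcpt hKint
  have hcl : IsClosed (reflectH l ω ⁻¹' K) := hKcpt.isClosed.preimage (continuous_reflectH l ω)
  have hmD : MeasurableSet (K \ reflectH l ω ⁻¹' K) :=
    hKcpt.measurableSet.diff hcl.measurableSet
  have hD : ∫ y in K \ reflectH l ω ⁻¹' K, -(⟪y, ω⟫ - l) = 0 := by
    rw [integral_neg, ← setIntegral_inner_sub_eq_diff hKcpt hω, neg_eq_zero]
    rw [hM, sub_self] at h
    exact (mul_eq_zero.1 h.symm).resolve_left (inv_ne_zero hv.ne')
  have hnull : volume (K \ reflectH l ω ⁻¹' K) = 0 := by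
    by_contra hne
    have hpos := (setIntegral_pos_iff_support_of_nonneg_ae
      (f := fun y => -(⟪y, ω⟫ - l)) (s := K \ reflectH l ω ⁻¹' K) (μ := volume)
      ((ae_restrict_iff' hmD).2 (.of_forall fun y hy =>
        (neg_pos.2 (inner_sub_neg_of_mem_diff hl hy)).le))
      ((integrableOn_inner_sub hKcpt l ω).mono_set sdiff_subset).neg).2 (by
        rw [inter_eq_right.2]
        · exact pos_iff_ne_zero.2 hne
        · exact fun y hy => (neg_pos.2 (inner_sub_neg_of_mem_diff hl hy)).ne')
    exact hpos.ne' hD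
  have hint : interior K ⊆ reflectH l ω ⁻¹' K := by
    rw [← sdiff_eq_empty]
    exact (isOpen_interior.sdiff hcl).eq_empty_of_measure_zero
      (measure_mono_null (sdiff_subset_sdiff_left interior_subset) hnull)
  have hsub : K ⊆ reflectH l ω ⁻¹' K := by
    calc K ⊆ closure K := subset_closure
      _ = closure (interior K) := (hKconv.closure_interior_eq_closure_of_nonempty_interior hKint).symm
      _ ⊆ _ := closure_minimal hint hcl
  exact (image_subset_iff.2 hsub).antisymm
    fun y hy => ⟨reflectH l ω y, hsub hy, reflectH_reflectH l hω y⟩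

/-- The infimum defining the folding function is attained. -/
lemma reflectH_foldingFn_image_subset {N : ℕ} {K : Set (EuclideanSpace ℝ (Fin N))}
    (hKcpt : IsCompact K) (hKint : (interior K).Nonempty)
    {ω : EuclideanSpace ℝ (Fin N)} (hω : ‖ω‖ = 1) :
    reflectH (foldingFn K ω) ω '' {x ∈ K | foldingFn K ω ≤ ⟪x, ω⟫} ⊆ K := by
  have hbdd : BddBelow {l : ℝ | reflectH l ω '' {x ∈ K | l ≤ ⟪x, ω⟫} ⊆ K} :=
    ⟨_, fun l hl => inner_centerOfMass_le_of_image_subset hKcpt hKint hω hl⟩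
  rintro _ ⟨x, ⟨hx, hxl⟩, rfl⟩
  rcases hxl.eq_or_lt with h | h
  · simpa [reflectH, h] using hx
  · have hne : {l : ℝ | reflectH l ω '' {x ∈ K | l ≤ ⟪x, ω⟫} ⊆ K}.Nonempty := by
      obtain ⟨b, hb⟩ := (hKcpt.image (f := fun y => ⟪y, ω⟫) (by fun_prop)).bddAbove
      refine ⟨b + 1, ?_⟩
      rintro _ ⟨y, ⟨hy, hyb⟩, rfl⟩
      have := hb (mem_image_of_mem _ hy)
      linarith
    have hlim := csInf_mem_closure hne hbdd
    have hcont : Continuous fun l : ℝ => reflectH l ω x := by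
      unfold reflectH
      fun_prop
    have hcl : IsClosed {l : ℝ | reflectH l ω x ∈ K} := hKcpt.isClosed.preimage hcont
    change foldingFn K ω ∈ {l : ℝ | reflectH l ω x ∈ K}
    rw [← hcl.closure_eq, _root_.mem_closure_iff]
    intro o ho hmem
    obtain ⟨l, ⟨hlo, hlx⟩, hl⟩ := _root_.mem_closure_iff.1 hlim (o ∩ Iio ⟪x, ω⟫) (ho.inter isOpen_Iio)
      ⟨hmem, h⟩
    exact ⟨l, hlo, hl ⟨x, ⟨hx, le_of_lt hlx⟩, rfl⟩⟩

/-- `R_K(ω) ≥ ⟪M_K, ω⟫`, with equality iff `K` is `ω`-symmetric. -/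
theorem statement1 {N : ℕ} (K : Set (EuclideanSpace ℝ (Fin N)))
    (hKcpt : IsCompact K) (hKconv : Convex ℝ K) (hKint : (interior K).Nonempty)
    (ω : EuclideanSpace ℝ (Fin N)) (hω : ‖ω‖ = 1) :
    ⟪centerOfMass K, ω⟫ ≤ foldingFn K ω ∧
    (foldingFn K ω = ⟪centerOfMass K, ω⟫ ↔ ∃ l : ℝ, reflectH l ω '' K = K) := by
  have hmem := reflectH_foldingFn_image_subset hKcpt hKint hω
  have hle := inner_centerOfMass_le_of_image_subset hKcpt hKint hω hmem
  refine ⟨hle, fun h => ⟨_, reflectH_image_eq_of_inner_centerOfMass_eq hKcpt hKconv hKint hω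
    hmem h.symm⟩, ?_⟩
  rintro ⟨l, hl⟩
  have hpre : reflectH l ω ⁻¹' K = K := by
    conv_lhs => rw [← hl]
    exact preimage_image_eq _ (Function.LeftInverse.injective (reflectH_reflectH l hω))
  have hM := inner_centerOfMass_sub hKcpt hKint l ω
  rw [setIntegral_inner_sub_eq_zero hω hpre, mul_zero, sub_eq_zero] at hM
  refine le_antisymm ?_ hle
  rw [hM]
  exact csInf_le ⟨_, fun l hl => inner_centerOfMass_le_of_image_subset hKcpt hKint hω hl⟩
    ((image_mono (sep_subset _ _)).trans hl.subset)
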